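/- Let a, b, c, d be positive real numbers satisfying c ≤ 1, d ≤ 1, c + d ≤ 1 + a + a·b, and c + d ≤ 1 + b + a·b. Then (c+d−1)·(a − a·d + c)/(1+a) + (c+d−1)·(b − b·c + d)/(1+b) ≤ (3/√5 − 1)·(a + b + c + d + a·b). -/

import Mathlib

/-- The excess of the extremal added area over `K` times the pentagon area, at `s = c + d - 1`
and `t = (1 + a) * (1 + b) - s`. -/
noncomputable def pentagonExcess (K s t : ℝ) : ℝ :=
  s + s ^ 2 / t - s ^ 3 / (t + s) - K * (t + 2 * s)

lemma pentagonExcess_mono_left {K s s' t : ℝ} (hK : 2 * K ≤ 1) (hs : 0 ≤ s) (hss : s ≤ s')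
    (hs1 : s' ≤ 1) (ht : 0 < t) (ht2 : t ≤ 2) :
    pentagonExcess K s t ≤ pentagonExcess K s' t := by
  have hs' : 0 ≤ s' := hs.trans hss
  have hp : 0 ≤ s * s' := mul_nonneg hs hs'
  have key : 0 ≤ (s + s') * (t + s) * (t + s')
      - t * (t * (s' ^ 2 + s * s' + s ^ 2) + s * s' * (s + s')) := by
    have h1 : 0 ≤ t ^ 2 * (s' * (1 - s')) :=
      mul_nonneg (sq_nonneg t) (mul_nonneg hs' (by linarith))
    have h2 : 0 ≤ t ^ 2 * (s * (1 - s)) :=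
      mul_nonneg (sq_nonneg t) (mul_nonneg hs (by linarith))
    have h3 : 0 ≤ t * (s - s') ^ 2 := by positivity
    have h4 : 0 ≤ s * s' * (t * (2 - t)) :=
      mul_nonneg hp (mul_nonneg ht.le (by linarith))
    have h5 : 0 ≤ s * s' * (t * (2 - s - s')) :=
      mul_nonneg hp (mul_nonneg ht.le (by linarith))
    have h6 : 0 ≤ s * s' * (s + s') := by positivity
    linarith
  have hid : pentagonExcess K s' t - pentagonExcess K s t = (s' - s) * ((1 - 2 * K) +
      ((s + s') * (t + s) * (t + s')
        - t * (t * (s' ^ 2 + s * s' + s ^ 2) + s * s' * (s + s'))) /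
        (t * (t + s) * (t + s'))) := by
    have h1 : t + s ≠ 0 := by positivity
    have h2 : t + s' ≠ 0 := by positivity
    unfold pentagonExcess
    field_simp
    ring
  have : 0 ≤ pentagonExcess K s' t - pentagonExcess K s t := by
    rw [hid]
    exact mul_nonneg (by linarith) (add_nonneg (by linarith) (div_nonneg key (by positivity)))
  linarith

lemma pentagonExcess_anti_right {K s t t' : ℝ} (hK : 0 ≤ K) (hs : 0 ≤ s) (hs1 : s ≤ 1)
    (ht : 0 < t) (htt : t ≤ t') :
    pentagonExcess K s t' ≤ pentagonExcess K s t := by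
  have ht' : 0 < t' := ht.trans_le htt
  have hid : pentagonExcess K s t - pentagonExcess K s t' = (t' - t) * (K +
      s ^ 2 * ((t + s) * (t' + s) - s * (t * t')) / (t * t' * (t + s) * (t' + s))) := by
    have h1 : t + s ≠ 0 := by positivity
    have h2 : t' + s ≠ 0 := by positivity
    unfold pentagonExcess
    field_simp
    ring
  have key : 0 ≤ (t + s) * (t' + s) - s * (t * t') := by
    have h1 : 0 ≤ (1 - s) * (t * t') := mul_nonneg (by linarith) (by positivity)
    have h2 : 0 ≤ s * (t + t') + s ^ 2 := by positivity
    linarith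
  have : 0 ≤ pentagonExcess K s t - pentagonExcess K s t' := by
    rw [hid]
    exact mul_nonneg (by linarith)
      (add_nonneg hK (div_nonneg (mul_nonneg (sq_nonneg s) key) (by positivity)))
  linarith

lemma pentagonExcess_nonpos {s t : ℝ} (hs : 0 ≤ s) (hs1 : s ≤ 1) (ht : 1 < t)
    (hst : s ≤ t ^ 2 - t) :
    pentagonExcess (3 / Real.sqrt 5 - 1) s t ≤ 0 := by
  have hg2 : Real.goldenRatio ^ 2 = Real.goldenRatio + 1 := Real.goldenRatio_sq
  have hr : 3 / Real.sqrt 5 - 1 = (6 * Real.goldenRatio - 8) / 5 := by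
    have h5 : Real.sqrt 5 ^ 2 = 5 := Real.sq_sqrt (by norm_num)
    have h0 : Real.sqrt 5 ≠ 0 := by positivity
    unfold Real.goldenRatio
    field_simp
    linarith
  rw [hr]
  have hg1 : 1.618 < Real.goldenRatio := by
    nlinarith [Real.one_lt_goldenRatio]
  have hg3 : Real.goldenRatio < 1.6181 := by
    nlinarith [Real.one_lt_goldenRatio]
  generalize Real.goldenRatio = g at *
  have hK0 : 0 ≤ (6 * g - 8) / 5 := by linarith
  have hK1 : 2 * ((6 * g - 8) / 5) ≤ 1 := by linarith
  rcases le_total g t with hgt | htg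
  · calc pentagonExcess ((6 * g - 8) / 5) s t
        ≤ pentagonExcess ((6 * g - 8) / 5) s g :=
          pentagonExcess_anti_right hK0 hs hs1 (by linarith) hgt
      _ ≤ pentagonExcess ((6 * g - 8) / 5) 1 g :=
          pentagonExcess_mono_left hK1 hs hs1 le_rfl (by linarith) (by linarith)
      _ = 0 := by
          have h0 : g ≠ 0 := by linarith
          unfold pentagonExcess
          rw [← hg2]
          field_simp
          linear_combination (-6 * g ^ 2 - 10 * g + 5) * hg2
  · have hmono := pentagonExcess_mono_left hK1 hs hst (by nlinarith) (by linarith)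
      (show t ≤ 2 by linarith)
    have ht0 : t ≠ 0 := by linarith
    have heq : pentagonExcess ((6 * g - 8) / 5) (t ^ 2 - t) t =
        -(t * ((g - t) * (1 - 2 * ((6 * g - 8) / 5) + (t - 1) + (g - 1)
          - ((t - 1) ^ 2 + (t - 1) * (g - 1) + (g - 1) ^ 2)))) := by
      have hts : t + (t ^ 2 - t) = t ^ 2 := by ring
      unfold pentagonExcess
      rw [hts]
      field_simp
      linear_combination (-5 * g + 3) * hg2
    have hfac : 0 ≤ 1 - 2 * ((6 * g - 8) / 5) + (t - 1) + (g - 1)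
        - ((t - 1) ^ 2 + (t - 1) * (g - 1) + (g - 1) ^ 2) := by
      nlinarith [mul_nonneg (sub_nonneg.2 ht.le) (sub_nonneg.2 htg)]
    have : 0 ≤ t * ((g - t) * (1 - 2 * ((6 * g - 8) / 5) + (t - 1) + (g - 1)
          - ((t - 1) ^ 2 + (t - 1) * (g - 1) + (g - 1) ^ 2))) :=
      mul_nonneg (by linarith) (mul_nonneg (by linarith) hfac)
    linarith

/-- The algebraic core of the pentagon circumscription theorem. -/
theorem pentagon_core_inequality (a b c d : ℝ)
    (ha : 0 < a) (hb : 0 < b) (hc : 0 < c) (hd : 0 < d)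
    (hc1 : c ≤ 1) (hd1 : d ≤ 1)
    (he : c + d ≤ 1 + a + a * b) (hf : c + d ≤ 1 + b + a * b) :
    (c + d - 1) * (a - a * d + c) / (1 + a) + (c + d - 1) * (b - b * c + d) / (1 + b) ≤
      (3 / Real.sqrt 5 - 1) * (a + b + c + d + a * b) := by
  have hK : 0 ≤ 3 / Real.sqrt 5 - 1 := by
    have h5 : Real.sqrt 5 ≤ 3 := Real.sqrt_le_iff.2 (by norm_num)
    rw [sub_nonneg, one_le_div (by positivity)]
    exact h5
  have hab : 0 < a * b := mul_pos ha hb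
  have hlhs : (c + d - 1) * (a - a * d + c) / (1 + a) +
      (c + d - 1) * (b - b * c + d) / (1 + b) =
      (c + d - 1) + (c + d - 1) ^ 2 * ((1 - a * b) / ((1 + a) * (1 + b))) := by
    field_simp
    ring
  rcases le_total (c + d) 1 with hcd | hcd
  · have hA : 0 ≤ (a * (1 - d) + c) / (1 + a) + (b * (1 - c) + d) / (1 + b) := by
      have h1 := mul_nonneg ha.le (sub_nonneg.2 hd1)
      have h2 := mul_nonneg hb.le (sub_nonneg.2 hc1)
      positivity
    calc _ = (c + d - 1) *
          ((a * (1 - d) + c) / (1 + a) + (b * (1 - c) + d) / (1 + b)) := by ring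
      _ ≤ 0 := mul_nonpos_of_nonpos_of_nonneg (by linarith) hA
      _ ≤ _ := mul_nonneg hK (by positivity)
  · obtain ⟨s, hs⟩ : ∃ s, s = c + d - 1 := ⟨_, rfl⟩
    obtain ⟨t, ht⟩ : ∃ t, t = (1 + a) * (1 + b) - s := ⟨_, rfl⟩
    have hat : 0 ≤ t - (1 + a) := by linarith
    have hbt : 0 ≤ t - (1 + b) := by linarith
    have hprod := mul_nonneg hat hbt
    have ht1 : 1 < t := by linarith
    have hP : (1 + a) * (1 + b) = t + s := by linarith
    have hst : s ≤ t ^ 2 - t := by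
      nlinarith [mul_nonneg hat (by linarith : (0 : ℝ) ≤ 1 + b), mul_nonneg hbt (by linarith : 0 ≤ t)]
    have hmain := pentagonExcess_nonpos (by linarith) (by linarith) ht1 hst
    have hbound : (1 - a * b) / ((1 + a) * (1 + b)) ≤ 1 / t - s / (t + s) := by
      rw [hP, div_sub_div _ _ (by linarith) (by linarith),
        div_le_div_iff₀ (by linarith) (mul_pos (by linarith) (by linarith))]
      have : 0 ≤ (t + s) * ((t - (1 + a)) * (t - (1 + b))) := mul_nonneg (by linarith) hprod
      have hab' : a * b = t + s - 1 - a - b := by linarith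
      have hid : (1 * (t + s) - t * s) * (t + s) - (1 - a * b) * (t * (t + s)) =
          (t + s) * ((t - (1 + a)) * (t - (1 + b))) := by
        linear_combination (t + s) * t * hab' - (t + s) * hP
      linarith
    have hmul := mul_le_mul_of_nonneg_left hbound (sq_nonneg s)
    rw [hlhs, ← hs]
    have hex : pentagonExcess (3 / Real.sqrt 5 - 1) s t = s + s ^ 2 * (1 / t - s / (t + s))
        - (3 / Real.sqrt 5 - 1) * (t + 2 * s) := by
      unfold pentagonExcess
      ring
    have harea : a + b + c + d + a * b = t + 2 * s := by linarith
    rw [harea]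
    linarith
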